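/- arXiv:2409.19198 — 4 statements merged into one kernel-verified Lean document; each statement's English description precedes it below -/
import Mathlib

section
/- Let M and N be Puiseux monoids such that N is finitely generated. If M is strongly atomic, then the internal sum M + N is strongly atomic. -/
namespace PuiseuxSum

/-- `a` is an atom of the Puiseux monoid `M`: it is a nonzero element of `M`
that cannot be written as a sum of two nonzero elements of `M`. -/
def IsAtom (M : AddSubmonoid ℚ) (a : ℚ) : Prop :=
  a ∈ M ∧ a ≠ 0 ∧ ∀ b ∈ M, ∀ c ∈ M, a = b + c → b = 0 ∨ c = 0

/-- The Puiseux monoid `M` is atomic if every element of `M` belongs to the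
additive submonoid generated by the atoms of `M`. -/
def Atomic (M : AddSubmonoid ℚ) : Prop :=
  ∀ x ∈ M, x ∈ AddSubmonoid.closure {a : ℚ | IsAtom M a}
/-- `c` divides `b` in `M` if `b = c + d` for some `d ∈ M`. -/
def DividesIn (M : AddSubmonoid ℚ) (c b : ℚ) : Prop :=
  ∃ d ∈ M, b = c + d

/-- `d` is a maximal common divisor of `x` and `y` in `M`: it is a common
divisor of `x` and `y` in `M` such that the only common divisor of `x - d` and
`y - d` in `M` is `0`. -/
def IsMCD (M : AddSubmonoid ℚ) (x y d : ℚ) : Prop :=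
  d ∈ M ∧ DividesIn M d x ∧ DividesIn M d y ∧
    ∀ e ∈ M, DividesIn M e (x - d) → DividesIn M e (y - d) → e = 0

/-- `M` is strongly atomic if it is atomic and every pair of elements of `M`
has a maximal common divisor in `M`. -/
def StronglyAtomic (M : AddSubmonoid ℚ) : Prop :=
  Atomic M ∧ ∀ x ∈ M, ∀ y ∈ M, ∃ d, IsMCD M x y d
theorem mem_sup_closure_singleton {M : AddSubmonoid ℚ} {q x : ℚ} :
    x ∈ M ⊔ AddSubmonoid.closure {q} ↔ ∃ m ∈ M, ∃ k : ℕ, x = m + k * q := by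
  simp only [AddSubmonoid.mem_sup, AddSubmonoid.mem_closure_singleton]
  constructor
  · rintro ⟨m, hm, _, ⟨k, rfl⟩, rfl⟩
    exact ⟨m, hm, k, by simp⟩
  · rintro ⟨m, hm, k, rfl⟩
    exact ⟨m, hm, _, ⟨k, rfl⟩, by simp⟩

theorem self_mem_sup_closure_singleton (M : AddSubmonoid ℚ) (q : ℚ) :
    q ∈ M ⊔ AddSubmonoid.closure {q} :=
  AddSubmonoid.mem_sup_right (AddSubmonoid.mem_closure_of_mem rfl)

/-- An element of `M + ℕ q` that is not divisible by `q` lies in `M`. -/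
theorem mem_of_not_dividesIn {M : AddSubmonoid ℚ} {q x : ℚ}
    (hx : x ∈ M ⊔ AddSubmonoid.closure {q})
    (hq : ¬ DividesIn (M ⊔ AddSubmonoid.closure {q}) q x) : x ∈ M := by
  obtain ⟨m, hm, k, rfl⟩ := mem_sup_closure_singleton.1 hx
  cases k with
  | zero => simpa using hm
  | succ k =>
    refine absurd ⟨m + k * q, mem_sup_closure_singleton.2 ⟨m, hm, k, rfl⟩, ?_⟩ hq
    push_cast
    ring

theorem DividesIn.add_right {M : AddSubmonoid ℚ} {c x y : ℚ} (h : DividesIn M c x)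
    (hy : y ∈ M) : DividesIn M c (x + y) := by
  obtain ⟨d, hd, rfl⟩ := h
  exact ⟨d + y, M.add_mem hd hy, by ring⟩

theorem DividesIn.of_sub {M : AddSubmonoid ℚ} {c x y : ℚ} (h : DividesIn M c (x - y))
    (hy : y ∈ M) : DividesIn M c x := by
  simpa using h.add_right hy

theorem DividesIn.sub_mem {M : AddSubmonoid ℚ} {c x : ℚ} (h : DividesIn M c x) :
    x - c ∈ M := by
  obtain ⟨d, hd, rfl⟩ := h
  simpa using hd

theorem dividesIn_iff_sub_mem {M : AddSubmonoid ℚ} {c x : ℚ} :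
    DividesIn M c x ↔ x - c ∈ M :=
  ⟨DividesIn.sub_mem, fun h => ⟨x - c, h, by ring⟩⟩

theorem IsMCD.add_left {M : AddSubmonoid ℚ} {x y e d : ℚ} (he : e ∈ M)
    (h : IsMCD M (x - e) (y - e) d) : IsMCD M x y (e + d) := by
  obtain ⟨hd, hx, hy, hmax⟩ := h
  rw [dividesIn_iff_sub_mem, sub_sub] at hx hy
  refine ⟨M.add_mem he hd, dividesIn_iff_sub_mem.2 hx, dividesIn_iff_sub_mem.2 hy, ?_⟩
  simpa only [sub_sub] using hmax

theorem nonneg_of_mem_sup {M N : AddSubmonoid ℚ} (hM : ∀ x ∈ M, (0 : ℚ) ≤ x)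
    (hN : ∀ x ∈ N, (0 : ℚ) ≤ x) : ∀ x ∈ M ⊔ N, (0 : ℚ) ≤ x := by
  intro x hx
  obtain ⟨m, hm, n, hn, rfl⟩ := AddSubmonoid.mem_sup.1 hx
  exact add_nonneg (hM m hm) (hN n hn)

theorem nonneg_of_mem_closure {s : Set ℚ} (hs : ∀ x ∈ s, (0 : ℚ) ≤ x) :
    ∀ x ∈ AddSubmonoid.closure s, (0 : ℚ) ≤ x := fun _ hx =>
  (AddSubmonoid.closure_le (S := AddSubmonoid.nonneg ℚ)).2 hs hx

theorem isAtom_sup_closure_singleton_self {M : AddSubmonoid ℚ} {q : ℚ}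
    (hM : ∀ x ∈ M, (0 : ℚ) ≤ x) (hq : 0 < q) (hqM : q ∉ M) :
    IsAtom (M ⊔ AddSubmonoid.closure {q}) q := by
  have hM' := nonneg_of_mem_sup hM (nonneg_of_mem_closure (s := {q}) (by simp [hq.le]))
  refine ⟨self_mem_sup_closure_singleton M q, hq.ne', fun b hb c hc hbc => ?_⟩
  by_contra! h
  have hb0 := (hM' b hb).lt_of_ne' h.1
  have hc0 := (hM' c hc).lt_of_ne' h.2
  refine hqM (hbc ▸ M.add_mem (mem_of_not_dividesIn hb ?_) (mem_of_not_dividesIn hc ?_)) <;>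
  · rintro ⟨d, hd, h⟩
    linarith [hM' d hd]

theorem IsAtom.sup_closure_singleton {M : AddSubmonoid ℚ} {q a : ℚ} (ha : IsAtom M a)
    (hqa : ¬ DividesIn (M ⊔ AddSubmonoid.closure {q}) q a) :
    IsAtom (M ⊔ AddSubmonoid.closure {q}) a := by
  refine ⟨AddSubmonoid.mem_sup_left ha.1, ha.2.1, fun b hb c hc hbc => ?_⟩
  subst hbc
  exact ha.2.2 b (mem_of_not_dividesIn hb fun h => hqa (h.add_right hc))
    c (mem_of_not_dividesIn hc fun h => hqa (add_comm b c ▸ h.add_right hb)) rfl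

theorem Atomic.sup_closure_singleton {M : AddSubmonoid ℚ} {q : ℚ}
    (hM : ∀ x ∈ M, (0 : ℚ) ≤ x) (hq : 0 < q) (hqM : q ∉ M) (hat : Atomic M) :
    Atomic (M ⊔ AddSubmonoid.closure {q}) := by
  have hM' := nonneg_of_mem_sup hM (nonneg_of_mem_closure (s := {q}) (by simp [hq.le]))
  have key : ∀ n : ℕ, ∀ x ∈ M ⊔ AddSubmonoid.closure {q}, x < n * q →
      x ∈ AddSubmonoid.closure {a : ℚ | IsAtom (M ⊔ AddSubmonoid.closure {q}) a} := by
    intro n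
    induction n with
    | zero =>
      intro x hx hlt
      have := hM' x hx
      simp at hlt
      linarith
    | succ n ih =>
      intro x hx hlt
      by_cases hqx : DividesIn (M ⊔ AddSubmonoid.closure {q}) q x
      · obtain ⟨d, hd, rfl⟩ := hqx
        refine add_mem (AddSubmonoid.subset_closure
          (isAtom_sup_closure_singleton_self hM hq hqM)) (ih d hd ?_)
        push_cast at hlt
        linarith
      · have hxM := hat x (mem_of_not_dividesIn hx hqx)
        clear hlt hx
        have hle : AddSubmonoid.closure {a : ℚ | IsAtom M a} ≤ M ⊔ AddSubmonoid.closure {q} :=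
          (AddSubmonoid.closure_le.2 fun a ha => ha.1).trans le_sup_left
        induction hxM using AddSubmonoid.closure_induction with
        | mem a ha => exact AddSubmonoid.subset_closure (ha.sup_closure_singleton hqx)
        | zero => exact zero_mem _
        | add y z hy hz ihy ihz =>
          exact add_mem (ihy fun h => hqx (h.add_right (hle hz)))
            (ihz fun h => hqx (add_comm y z ▸ h.add_right (hle hy)))
  intro x hx
  obtain ⟨n, hn⟩ := exists_nat_gt (x / q)
  exact key n x hx ((div_lt_iff₀ hq).1 hn)

/-- If `q` is not a common divisor of `x` and `y` in `M + ℕ q`, then `x` and `y` have a maximal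
common divisor there. The induction is on a finite set of pairs `(i, j)` containing all those with
`x - i q ∈ M` and `y - j q ∈ M`. -/
theorem exists_isMCD_of_not_dividesIn {M : AddSubmonoid ℚ} {q : ℚ}
    (hmcd : ∀ x ∈ M, ∀ y ∈ M, ∃ d, IsMCD M x y d) (s : Finset (ℕ × ℕ)) :
    ∀ x ∈ M ⊔ AddSubmonoid.closure {q}, ∀ y ∈ M ⊔ AddSubmonoid.closure {q},
      (∀ i j : ℕ, x - i * q ∈ M → y - j * q ∈ M → (i, j) ∈ s) →
      ¬ (DividesIn (M ⊔ AddSubmonoid.closure {q}) q x ∧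
        DividesIn (M ⊔ AddSubmonoid.closure {q}) q y) →
      ∃ d, IsMCD (M ⊔ AddSubmonoid.closure {q}) x y d := by
  induction s using Finset.strongInduction with
  | H s ih =>
  intro x hx y hy hs hq
  obtain ⟨a, ha, i, hi⟩ := mem_sup_closure_singleton.1 hx
  obtain ⟨b, hb, j, hj⟩ := mem_sup_closure_singleton.1 hy
  have hxa : x - i * q = a := by rw [hi]; ring
  have hyb : y - j * q = b := by rw [hj]; ring
  obtain ⟨d, hd, hda, hdb, hmax⟩ := hmcd a ha b hb
  have hd' : d ∈ M ⊔ AddSubmonoid.closure {q} := AddSubmonoid.mem_sup_left hd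
  have hdx : DividesIn (M ⊔ AddSubmonoid.closure {q}) d x := dividesIn_iff_sub_mem.2 <|
    mem_sup_closure_singleton.2 ⟨_, hda.sub_mem, i, by rw [hi]; ring⟩
  have hdy : DividesIn (M ⊔ AddSubmonoid.closure {q}) d y := dividesIn_iff_sub_mem.2 <|
    mem_sup_closure_singleton.2 ⟨_, hdb.sub_mem, j, by rw [hj]; ring⟩
  by_cases hdone : IsMCD (M ⊔ AddSubmonoid.closure {q}) x y d
  · exact ⟨d, hdone⟩
  obtain ⟨e, he, hex, hey, he0⟩ : ∃ e ∈ M ⊔ AddSubmonoid.closure {q},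
      DividesIn (M ⊔ AddSubmonoid.closure {q}) e (x - d) ∧
      DividesIn (M ⊔ AddSubmonoid.closure {q}) e (y - d) ∧ e ≠ 0 := by
    by_contra! h
    exact hdone ⟨hd', hdx, hdy, h⟩
  have hxe := hex.sub_mem
  have hye := hey.sub_mem
  have heM : e ∈ M := by
    refine mem_of_not_dividesIn he fun h => hq ⟨?_, ?_⟩
    · exact (add_sub_cancel e (x - d) ▸ h.add_right hxe).of_sub hd'
    · exact (add_sub_cancel e (y - d) ▸ h.add_right hye).of_sub hd'
  have hde : d + e ∈ M := M.add_mem hd heM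
  have hde' : d + e ∈ M ⊔ AddSubmonoid.closure {q} := AddSubmonoid.mem_sup_left hde
  rw [sub_sub] at hxe hye
  obtain ⟨f, hf⟩ := ih (s.erase (i, j))
    (Finset.erase_ssubset (hs i j (hxa ▸ ha) (hyb ▸ hb))) _ hxe _ hye
    (fun k l hk hl => by
      refine Finset.mem_erase.2 ⟨?_, hs k l ?_ ?_⟩
      · rintro ⟨rfl, rfl⟩
        refine he0 (hmax e heM (dividesIn_iff_sub_mem.2 ?_) (dividesIn_iff_sub_mem.2 ?_))
        · convert hk using 1
          rw [← hxa]
          ring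
        · convert hl using 1
          rw [← hyb]
          ring
      · convert M.add_mem hk hde using 1
        ring
      · convert M.add_mem hl hde using 1
        ring)
    (fun h => hq ⟨h.1.of_sub hde', h.2.of_sub hde'⟩)
  exact ⟨_, hf.add_left hde'⟩

theorem exists_isMCD_sup_closure_singleton {M : AddSubmonoid ℚ} {q : ℚ}
    (hM : ∀ x ∈ M, (0 : ℚ) ≤ x) (hq : 0 < q)
    (hmcd : ∀ x ∈ M, ∀ y ∈ M, ∃ d, IsMCD M x y d) :
    ∀ x ∈ M ⊔ AddSubmonoid.closure {q}, ∀ y ∈ M ⊔ AddSubmonoid.closure {q},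
      ∃ d, IsMCD (M ⊔ AddSubmonoid.closure {q}) x y d := by
  have hM' := nonneg_of_mem_sup hM (nonneg_of_mem_closure (s := {q}) (by simp [hq.le]))
  have key : ∀ n : ℕ, ∀ x ∈ M ⊔ AddSubmonoid.closure {q}, x < n * q →
      ∀ y ∈ M ⊔ AddSubmonoid.closure {q},
        ∃ d, IsMCD (M ⊔ AddSubmonoid.closure {q}) x y d := by
    intro n
    induction n with
    | zero =>
      intro x hx hlt
      have := hM' x hx
      simp at hlt
      linarith
    | succ n ih =>
      intro x hx hlt y hy
      by_cases h : DividesIn (M ⊔ AddSubmonoid.closure {q}) q x ∧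
          DividesIn (M ⊔ AddSubmonoid.closure {q}) q y
      · push_cast at hlt
        obtain ⟨d, hd⟩ := ih _ h.1.sub_mem (by linarith) _ h.2.sub_mem
        exact ⟨_, hd.add_left (self_mem_sup_closure_singleton M q)⟩
      · have hbound : ∀ z : ℚ, ∀ i : ℕ, z - i * q ∈ M → i ≤ ⌊z / q⌋₊ := fun z i hi =>
          Nat.le_floor ((le_div_iff₀ hq).2 (sub_nonneg.1 (hM _ hi)))
        refine exists_isMCD_of_not_dividesIn hmcd
          (Finset.Iic ⌊x / q⌋₊ ×ˢ Finset.Iic ⌊y / q⌋₊) x hx y hy (fun i j hi hj => ?_) h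
        simpa using ⟨hbound x i hi, hbound y j hj⟩
  intro x hx
  obtain ⟨n, hn⟩ := exists_nat_gt (x / q)
  exact key n x hx ((div_lt_iff₀ hq).1 hn)

theorem StronglyAtomic.sup_closure_singleton {M : AddSubmonoid ℚ} {q : ℚ}
    (hM : ∀ x ∈ M, (0 : ℚ) ≤ x) (hq : 0 ≤ q) (hsa : StronglyAtomic M) :
    StronglyAtomic (M ⊔ AddSubmonoid.closure {q}) := by
  by_cases hqM : q ∈ M
  · rwa [sup_eq_left.2 (by simpa using hqM)]
  · have hq0 : 0 < q := hq.lt_of_ne (by rintro rfl; exact hqM M.zero_mem)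
    exact ⟨hsa.1.sup_closure_singleton hM hq0 hqM,
      exists_isMCD_sup_closure_singleton hM hq0 hsa.2⟩

/-- If `M` and `N` are Puiseux monoids such that `N` is finitely generated and
`M` is strongly atomic, then the internal sum `M + N` is strongly atomic. -/
theorem stronglyAtomic_sup_of_stronglyAtomic_of_fg (M N : AddSubmonoid ℚ)
    (hM : ∀ x ∈ M, (0 : ℚ) ≤ x) (hN : ∀ x ∈ N, (0 : ℚ) ≤ x)
    (hfg : N.FG) (hsa : StronglyAtomic M) :
    StronglyAtomic (M ⊔ N) := by
  obtain ⟨s, rfl⟩ := hfg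
  have hs : ∀ x ∈ s, (0 : ℚ) ≤ x := fun x hx => hN x (AddSubmonoid.subset_closure hx)
  clear hN
  induction s using Finset.induction_on with
  | empty => simpa using hsa
  | insert q s _ ih =>
    have hs' : ∀ x ∈ s, (0 : ℚ) ≤ x := fun x hx => hs x (Finset.mem_insert_of_mem hx)
    rw [Finset.coe_insert, Set.insert_eq, AddSubmonoid.closure_union, sup_comm
      (AddSubmonoid.closure {q}), ← sup_assoc]
    exact (ih hs').sup_closure_singleton
      (nonneg_of_mem_sup hM (nonneg_of_mem_closure hs')) (hs q (Finset.mem_insert_self q s))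

end PuiseuxSum
end

section
/- Let M be an atomic Puiseux monoid and let r be a positive rational number. Then the Puiseux monoid M + ℕ₀r (the internal sum of M with the cyclic monoid generated by r) is atomic. -/
namespace PuiseuxSum

/-- Membership in `M + ℕ₀r`. -/
theorem mem_sup_multiples {M : AddSubmonoid ℚ} {r x : ℚ} :
    x ∈ M ⊔ AddSubmonoid.closure {r} ↔ ∃ m ∈ M, ∃ k : ℕ, m + k * r = x := by
  simp [AddSubmonoid.mem_sup, AddSubmonoid.mem_closure_singleton]

/-- If `r ∉ M`, then `r` is an atom of `M + ℕ₀r`. -/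
theorem isAtom_sup_multiples_self {M : AddSubmonoid ℚ} (hM : ∀ x ∈ M, (0 : ℚ) ≤ x) {r : ℚ}
    (hr : 0 < r) (hrM : r ∉ M) : IsAtom (M ⊔ AddSubmonoid.closure {r}) r := by
  refine ⟨mem_sup_multiples.2 ⟨0, M.zero_mem, 1, by simp⟩, hr.ne', ?_⟩
  intro b hb c hc h
  obtain ⟨m, hm, k, rfl⟩ := mem_sup_multiples.1 hb
  obtain ⟨n, hn, l, rfl⟩ := mem_sup_multiples.1 hc
  have hm0 := hM m hm
  have hn0 := hM n hn
  have hk0 : 0 ≤ (k : ℚ) * r := by positivity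
  have hl0 : 0 ≤ (l : ℚ) * r := by positivity
  rcases Nat.eq_zero_or_pos k with rfl | hk
  · rcases Nat.eq_zero_or_pos l with rfl | hl
    · refine absurd ?_ hrM
      rw [h]
      simpa using M.add_mem hm hn
    · have hl1 : (1 : ℚ) ≤ l := by exact_mod_cast hl
      left
      nlinarith
  · have hk1 : (1 : ℚ) ≤ k := by exact_mod_cast hk
    right
    nlinarith

/-- An atom of `M` from which no positive multiple of `r` can be subtracted within `M`
is an atom of `M + ℕ₀r`. -/
theorem IsAtom.sup_multiples {M : AddSubmonoid ℚ} {a r : ℚ} (ha : IsAtom M a)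
    (h : ∀ k : ℕ, 0 < k → a - k * r ∉ M) : IsAtom (M ⊔ AddSubmonoid.closure {r}) a := by
  refine ⟨AddSubmonoid.mem_sup_left ha.1, ha.2.1, ?_⟩
  intro b hb c hc hbc
  obtain ⟨m, hm, k, rfl⟩ := mem_sup_multiples.1 hb
  obtain ⟨n, hn, l, rfl⟩ := mem_sup_multiples.1 hc
  rcases Nat.eq_zero_or_pos (k + l) with hkl | hkl
  · obtain ⟨rfl, rfl⟩ : k = 0 ∧ l = 0 := by omega
    simpa using ha.2.2 m hm n hn (by simpa using hbc)
  · refine absurd ?_ (h (k + l) hkl)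
    have : a - ((k + l : ℕ) : ℚ) * r = m + n := by
      rw [hbc]
      push_cast
      ring
    rw [this]
    exact M.add_mem hm hn

/-- A sum of atoms of `M` from which no positive multiple of `r` can be subtracted within `M`
is a sum of atoms of `M + ℕ₀r`. -/
theorem mem_closure_isAtom_sup_multiples {M : AddSubmonoid ℚ} {r x : ℚ}
    (hx : x ∈ AddSubmonoid.closure {a : ℚ | IsAtom M a})
    (h : ∀ k : ℕ, 0 < k → x - k * r ∉ M) :
    x ∈ AddSubmonoid.closure {a : ℚ | IsAtom (M ⊔ AddSubmonoid.closure {r}) a} := by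
  have hle : AddSubmonoid.closure {a : ℚ | IsAtom M a} ≤ M :=
    AddSubmonoid.closure_le.2 fun a ha => ha.1
  induction hx using AddSubmonoid.closure_induction with
  | mem a ha => exact AddSubmonoid.subset_closure (ha.sup_multiples h)
  | zero => exact zero_mem _
  | add y z hy hz ihy ihz =>
    refine add_mem (ihy fun k hk hmem => h k hk ?_) (ihz fun k hk hmem => h k hk ?_)
    · rw [add_sub_right_comm]
      exact M.add_mem hmem (hle hz)
    · rw [add_sub_assoc]
      exact M.add_mem (hle hy) hmem

/-- If `M` is an atomic Puiseux monoid and `r` is a positive rational, then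
`M + ℕ₀r` is atomic. -/
theorem atomic_sup_multiples (M : AddSubmonoid ℚ)
    (hM : ∀ x ∈ M, (0 : ℚ) ≤ x) (hatomic : Atomic M)
    (r : ℚ) (hr : 0 < r) :
    Atomic (M ⊔ AddSubmonoid.closure {r}) := by
  by_cases hrM : r ∈ M
  · rwa [sup_eq_left.2 (AddSubmonoid.closure_le.2 (Set.singleton_subset_iff.2 hrM))]
  set A := AddSubmonoid.closure {a : ℚ | IsAtom (M ⊔ AddSubmonoid.closure {r}) a} with hA
  have hrA (k : ℕ) : (k : ℚ) * r ∈ A := by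
    rw [← nsmul_eq_mul]
    exact A.nsmul_mem (AddSubmonoid.subset_closure (isAtom_sup_multiples_self hM hr hrM)) k
  have key (n : ℕ) : ∀ x ∈ M, x < n * r → x ∈ A := by
    induction n with
    | zero =>
      intro x hx hlt
      have := hM x hx
      simp at hlt
      linarith
    | succ n ih =>
      intro x hx hlt
      by_cases h : ∃ k : ℕ, 0 < k ∧ x - k * r ∈ M
      · obtain ⟨k, hk, hmem⟩ := h
        have hk1 : (1 : ℚ) ≤ k := by exact_mod_cast hk
        have hsub : x - k * r < n * r := by
          push_cast at hlt
          nlinarith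
        simpa using A.add_mem (ih _ hmem hsub) (hrA k)
      · push Not at h
        exact mem_closure_isAtom_sup_multiples (hatomic x hx) h
  intro x hx
  obtain ⟨m, hm, k, rfl⟩ := mem_sup_multiples.1 hx
  obtain ⟨n, hn⟩ := exists_nat_gt (m / r)
  exact A.add_mem (key n m hm ((div_lt_iff₀ hr).1 hn)) (hrA k)

end PuiseuxSum
end

section
/- There exist a strongly atomic additive submonoid M and a finitely generated additive submonoid N of ℤ² such that the internal sum M + N is not atomic. -/
namespace LatticeSum

/-- `u` is invertible in the additive submonoid `M` of `ℤ × ℤ`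
(for `u ∈ M`) if `-u ∈ M`. -/
def Invertible' (M : AddSubmonoid (ℤ × ℤ)) (u : ℤ × ℤ) : Prop :=
  -u ∈ M

/-- `a` is an atom of `M`: a non-invertible element of `M` such that whenever
`a = b + c` with `b, c ∈ M`, `b` or `c` is invertible in `M`. -/
def IsAtom (M : AddSubmonoid (ℤ × ℤ)) (a : ℤ × ℤ) : Prop :=
  a ∈ M ∧ ¬ Invertible' M a ∧
    ∀ b ∈ M, ∀ c ∈ M, a = b + c → Invertible' M b ∨ Invertible' M c

/-- `M` is atomic if every non-invertible element of `M` is a finite sum of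
atoms of `M`. -/
def Atomic (M : AddSubmonoid (ℤ × ℤ)) : Prop :=
  ∀ x ∈ M, ¬ Invertible' M x →
    ∃ s : Multiset (ℤ × ℤ), (∀ a ∈ s, IsAtom M a) ∧ s.sum = x

/-- `c` divides `b` in `M` if `b = c + d` for some `d ∈ M`. -/
def DividesIn (M : AddSubmonoid (ℤ × ℤ)) (c b : ℤ × ℤ) : Prop :=
  ∃ d ∈ M, b = c + d

/-- `d` is a maximal common divisor of `x` and `y` in `M`: a common divisor of
`x` and `y` such that every common divisor in `M` of `x - d` and `y - d` is
invertible in `M`. -/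
def IsMCD (M : AddSubmonoid (ℤ × ℤ)) (x y d : ℤ × ℤ) : Prop :=
  d ∈ M ∧ DividesIn M d x ∧ DividesIn M d y ∧
    ∀ e ∈ M, DividesIn M e (x - d) → DividesIn M e (y - d) → Invertible' M e

/-- `M` is strongly atomic if it is atomic and every pair of elements of `M`
has a maximal common divisor in `M`. -/
def StronglyAtomic (M : AddSubmonoid (ℤ × ℤ)) : Prop :=
  Atomic M ∧ ∀ x ∈ M, ∀ y ∈ M, ∃ d, IsMCD M x y d

/-- The additive submonoid `{(0,0)} ∪ (ℤ × ℕ≥1)` of `ℤ²`. -/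
def M₂ : AddSubmonoid (ℤ × ℤ) where
  carrier := {v : ℤ × ℤ | v = 0 ∨ 1 ≤ v.2}
  zero_mem' := Or.inl rfl
  add_mem' := by
    rintro a b (rfl | ha) (rfl | hb)
    · exact Or.inl (by simp)
    · exact Or.inr (by simpa using hb)
    · exact Or.inr (by simpa using ha)
    · exact Or.inr (by simpa using by omega)

/-- The additive submonoid `ℕ₀ × ℕ₀` of `ℤ²`. -/
def M₁ : AddSubmonoid (ℤ × ℤ) where
  carrier := {v : ℤ × ℤ | 0 ≤ v.1 ∧ 0 ≤ v.2}
  zero_mem' := ⟨le_refl 0, le_refl 0⟩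
  add_mem' := by
    rintro a b ⟨h1, h2⟩ ⟨h3, h4⟩
    exact ⟨add_nonneg h1 h3, add_nonneg h2 h4⟩

theorem mem_M₁ {v : ℤ × ℤ} : v ∈ M₁ ↔ 0 ≤ v.1 ∧ 0 ≤ v.2 := Iff.rfl

theorem mem_M₂ {v : ℤ × ℤ} : v ∈ M₂ ↔ v = 0 ∨ 1 ≤ v.2 := Iff.rfl

theorem snd_nonneg_of_mem_M₂ {v : ℤ × ℤ} (hv : v ∈ M₂) : 0 ≤ v.2 := by
  rcases hv with rfl | h
  · exact le_rfl
  · omega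

theorem isAtom_M₂ (n : ℤ) : IsAtom M₂ (n, 1) := by
  refine ⟨Or.inr le_rfl, ?_, ?_⟩
  · intro h
    have := snd_nonneg_of_mem_M₂ h
    simp at this
  · rintro b (rfl | hb) c (rfl | hc) h
    · exact Or.inl (Or.inl (by simp))
    · exact Or.inl (Or.inl (by simp))
    · exact Or.inr (Or.inl (by simp))
    · have := congrArg Prod.snd h
      simp at this
      omega

theorem atomic_M₂ : Atomic M₂ := by
  rintro x (rfl | hx) hinv
  · exact absurd (Or.inl (by simp)) hinv
  · refine ⟨(x.1, 1) ::ₘ Multiset.replicate (x.2 - 1).toNat (0, 1), ?_, ?_⟩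
    · intro a ha
      rcases Multiset.mem_cons.1 ha with rfl | ha
      · exact isAtom_M₂ _
      · rw [Multiset.eq_of_mem_replicate ha]
        exact isAtom_M₂ _
    · ext
      · simp
      · simp
        omega

theorem exists_isMCD_M₂ (x y : ℤ × ℤ) (hx : x ∈ M₂) (hy : y ∈ M₂) :
    ∃ d, IsMCD M₂ x y d := by
  obtain ⟨m, ⟨d, hd, hdx, hdy, rfl⟩, hmax⟩ := Int.exists_greatest_of_bdd
    (P := fun m ↦ ∃ d ∈ M₂, DividesIn M₂ d x ∧ DividesIn M₂ d y ∧ d.2 = m)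
    ⟨x.2, by
      rintro _ ⟨d, -, ⟨c, hc, rfl⟩, -, rfl⟩
      simpa using snd_nonneg_of_mem_M₂ hc⟩
    ⟨0, 0, zero_mem _, ⟨x, hx, by simp⟩, ⟨y, hy, by simp⟩, rfl⟩
  refine ⟨d, hd, hdx, hdy, ?_⟩
  rintro e he ⟨a, ha, hxa⟩ ⟨b, hb, hyb⟩
  have hle := hmax (d + e).2 ⟨d + e, add_mem hd he,
    ⟨a, ha, by rw [add_assoc, ← hxa]; abel⟩, ⟨b, hb, by rw [add_assoc, ← hyb]; abel⟩, rfl⟩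
  rcases he with rfl | he
  · exact Or.inl (by simp)
  · simp at hle
    omega

theorem fg_M₁ : M₁.FG := by
  refine ⟨{(1, 0), (0, 1)}, le_antisymm ?_ ?_⟩
  · rw [AddSubmonoid.closure_le]
    intro v hv
    simp at hv
    rcases hv with rfl | rfl <;> simp [mem_M₁]
  · rintro v ⟨h1, h2⟩
    have hv : v = v.1.toNat • ((1, 0) : ℤ × ℤ) + v.2.toNat • ((0, 1) : ℤ × ℤ) := by
      ext <;> simp [h1, h2]
    rw [hv]
    exact add_mem (nsmul_mem (AddSubmonoid.subset_closure (by simp)) _)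
      (nsmul_mem (AddSubmonoid.subset_closure (by simp)) _)

theorem mem_M₂_sup_M₁ {v : ℤ × ℤ} :
    v ∈ M₂ ⊔ M₁ ↔ (v.2 = 0 ∧ 0 ≤ v.1) ∨ 1 ≤ v.2 := by
  constructor
  · rw [AddSubmonoid.mem_sup]
    rintro ⟨a, rfl | ha, b, ⟨hb1, hb2⟩, rfl⟩
    · simp
      omega
    · simp
      omega
  · rintro (⟨h2, h1⟩ | h)
    · exact (le_sup_right : M₁ ≤ M₂ ⊔ M₁) ⟨h1, h2.ge⟩
    · exact (le_sup_left : M₂ ≤ M₂ ⊔ M₁) (Or.inr h)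

/-- An element of positive height splits off `(1, 0)`, so all atoms have height zero. -/
theorem snd_eq_zero_of_isAtom {a : ℤ × ℤ} (ha : IsAtom (M₂ ⊔ M₁) a) : a.2 = 0 := by
  obtain ⟨hmem, -, hsplit⟩ := ha
  rcases mem_M₂_sup_M₁.1 hmem with ⟨h, -⟩ | h
  · exact h
  · have := hsplit (1, 0) (mem_M₂_sup_M₁.2 (by simp)) (a.1 - 1, a.2)
      (mem_M₂_sup_M₁.2 (Or.inr h)) (by ext <;> simp)
    simp only [Invertible', mem_M₂_sup_M₁] at this
    simp at this
    omega

theorem not_atomic_M₂_sup_M₁ : ¬ Atomic (M₂ ⊔ M₁) := by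
  intro h
  obtain ⟨s, hs, hsum⟩ := h (0, 1) (mem_M₂_sup_M₁.2 (by simp))
    (by simp [Invertible', mem_M₂_sup_M₁])
  have hzero : s.sum.2 = 0 := Multiset.sum_induction (fun v : ℤ × ℤ ↦ v.2 = 0) s
    (fun a b ha hb ↦ by simp [ha, hb]) rfl (fun a ha ↦ snd_eq_zero_of_isAtom (hs a ha))
  simp [hsum] at hzero

/-- There exist a strongly atomic additive submonoid `M` of `ℤ²` and a
finitely generated additive submonoid `N` of `ℤ²` whose internal sum `M + N`
is not atomic. -/
theorem exists_stronglyAtomic_fg_sum_not_atomic :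
    ∃ M N : AddSubmonoid (ℤ × ℤ),
      StronglyAtomic M ∧ N.FG ∧ ¬ Atomic (M ⊔ N) := by
  exact ⟨M₂, M₁, ⟨atomic_M₂, fun x hx y hy ↦ exists_isMCD_M₂ x y hx hy⟩, fg_M₁,
    not_atomic_M₂_sup_M₁⟩

end LatticeSum
end

section
/- There exist atomic Puiseux monoids M₁ and M₂ such that their internal sum M₁ + M₂ has no atoms and is not the trivial monoid {0} (i.e., M₁ + M₂ is a nontrivial antimatter monoid). -/
namespace PuiseuxSum

/-- The sequence `p ^ n / 25 ^ (n ^ 2)`. -/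
def gen (p n : ℕ) : ℚ := (p : ℚ) ^ n / 25 ^ (n ^ 2)

/-- The Puiseux monoid generated by the sequence `gen p`. -/
def genMonoid (p : ℕ) : AddSubmonoid ℚ := AddSubmonoid.closure (Set.range (gen p))

lemma gen_pos {p : ℕ} (hp : 0 < p) (n : ℕ) : 0 < gen p n := by
  unfold gen; positivity

lemma gen_antitone {p : ℕ} (hp : p ≤ 25) : Antitone (gen p) := by
  refine antitone_nat_of_succ_le fun n => ?_
  unfold gen
  rw [div_le_div_iff₀ (by positivity) (by positivity)]
  have h : (p : ℚ) ≤ 25 ^ (2 * n + 1) :=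
    (by exact_mod_cast hp : (p : ℚ) ≤ 25).trans (le_self_pow₀ (by norm_num) (by lia))
  calc (p : ℚ) ^ (n + 1) * 25 ^ (n ^ 2) = p ^ n * (p * 25 ^ (n ^ 2)) := by ring
    _ ≤ p ^ n * (25 ^ (2 * n + 1) * 25 ^ (n ^ 2)) := by gcongr
    _ = p ^ n * 25 ^ ((n + 1) ^ 2) := by ring

lemma nonneg_of_mem_genMonoid {p : ℕ} {x : ℚ} (hx : x ∈ genMonoid p) : 0 ≤ x := by
  induction hx using AddSubmonoid.closure_induction with
  | mem x hx => obtain ⟨n, rfl⟩ := hx; unfold gen; positivity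
  | zero => rfl
  | add x y _ _ hx hy => exact add_nonneg hx hy

/-- Elements of `genMonoid p` below `gen p n` only involve later generators, so their numerators
are divisible by `p ^ (n + 1)`. -/
lemma exists_eq_of_lt_gen {p : ℕ} (hp : p ≤ 25) (n : ℕ) {x : ℚ} (hx : x ∈ genMonoid p)
    (hlt : x < gen p n) : ∃ j t : ℕ, x = (p : ℚ) ^ (n + 1) * t / 25 ^ j := by
  induction hx using AddSubmonoid.closure_induction with
  | mem x hx =>
    obtain ⟨m, rfl⟩ := hx
    have hnm : n < m := (gen_antitone hp).reflect_lt hlt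
    obtain ⟨k, rfl⟩ := Nat.exists_eq_add_of_lt hnm
    refine ⟨(n + k + 1) ^ 2, p ^ k, ?_⟩
    unfold gen
    push_cast
    ring
  | zero => exact ⟨0, 0, by simp⟩
  | add x y hx hy ihx ihy =>
    have hx0 := nonneg_of_mem_genMonoid hx
    have hy0 := nonneg_of_mem_genMonoid hy
    obtain ⟨i, s, hs⟩ := ihx (by linarith)
    obtain ⟨j, t, ht⟩ := ihy (by linarith)
    refine ⟨i + j, s * 25 ^ j + t * 25 ^ i, ?_⟩
    rw [hs, ht]
    push_cast
    field_simp
    ring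

lemma isAtom_gen {p : ℕ} (hp1 : 1 < p) (hp : p ≤ 25) (hcop : p.Coprime 25) (n : ℕ) :
    IsAtom (genMonoid p) (gen p n) := by
  refine ⟨AddSubmonoid.subset_closure ⟨n, rfl⟩, (gen_pos (by lia) n).ne', ?_⟩
  intro b hb c hc h
  by_contra! hne
  have hb0 := (nonneg_of_mem_genMonoid hb).lt_of_ne' hne.1
  have hc0 := (nonneg_of_mem_genMonoid hc).lt_of_ne' hne.2
  obtain ⟨i, s, hs⟩ := exists_eq_of_lt_gen hp n hb (by linarith)
  obtain ⟨j, t, ht⟩ := exists_eq_of_lt_gen hp n hc (by linarith)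
  have hpQ : (p : ℚ) ≠ 0 := by positivity
  rw [hs, ht] at h
  unfold gen at h
  have key : (25 : ℚ) ^ (i + j) = p * ((s * 25 ^ j + t * 25 ^ i) * 25 ^ (n ^ 2)) := by
    apply mul_left_cancel₀ (pow_ne_zero n hpQ)
    field_simp at h
    linear_combination h
  have key' : 25 ^ (i + j) = p * ((s * 25 ^ j + t * 25 ^ i) * 25 ^ (n ^ 2)) := by
    exact_mod_cast key
  have := Nat.Coprime.eq_one_of_dvd (hcop.pow_right (i + j)) ⟨_, key'⟩
  lia

lemma atomic_genMonoid {p : ℕ} (hp1 : 1 < p) (hp : p ≤ 25) (hcop : p.Coprime 25) :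
    Atomic (genMonoid p) := by
  intro x hx
  refine AddSubmonoid.closure_mono ?_ hx
  rintro _ ⟨n, rfl⟩
  exact isAtom_gen hp1 hp hcop n

/-- An atom of a monoid generated by `S` belongs to `S`. -/
lemma IsAtom.mem_of_closure {S : Set ℚ} {a : ℚ} (ha : IsAtom (AddSubmonoid.closure S) a) :
    a ∈ S := by
  obtain ⟨hmem, hne, hsplit⟩ := ha
  induction hmem using AddSubmonoid.closure_induction with
  | mem x hx => exact hx
  | zero => exact absurd rfl hne
  | add x y hx hy ihx ihy =>
    rcases hsplit x hx y hy rfl with rfl | rfl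
    · simp only [zero_add] at *
      exact ihy hne hsplit
    · simp only [add_zero] at *
      exact ihx hne hsplit

/-- Two coprime positive numbers represent every number above their product with positive
coefficients. -/
lemma exists_pos_mul_add_mul_eq {p q N : ℕ} (hp : 0 < p) (hq : 0 < q) (hcop : p.Coprime q)
    (hN : p * q < N) : ∃ k l : ℕ, 0 < k ∧ 0 < l ∧ k * p + l * q = N := by
  obtain ⟨p, rfl⟩ := Nat.exists_eq_succ_of_ne_zero hp.ne'
  obtain ⟨q, rfl⟩ := Nat.exists_eq_succ_of_ne_zero hq.ne'
  simp only [Nat.succ_eq_add_one] at *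
  have hN' : p * q + p + q + 1 < N := by linarith [add_one_mul p (q + 1), mul_add_one p q]
  obtain ⟨a, b, hab⟩ := Nat.exists_add_mul_eq_of_gcd_dvd_of_mul_pred_le (p + 1) (q + 1)
    (N - (p + 1) - (q + 1)) (by rw [hcop]; exact one_dvd _) (by simp; lia)
  refine ⟨a + 1, b + 1, by lia, by lia, ?_⟩
  rw [add_mul, add_mul]
  lia

/-- Each number `r ^ n / 25 ^ (n ^ 2)` is a positive integer combination of
`gen 2 (n + 1)` and `gen 3 (n + 1)`. -/
lemma exists_gen_eq {r : ℕ} (hr : 0 < r) (n : ℕ) :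
    ∃ k l : ℕ, 0 < k ∧ 0 < l ∧ gen r n = k * gen 2 (n + 1) + l * gen 3 (n + 1) := by
  have hlt : 2 ^ (n + 1) * 3 ^ (n + 1) < r ^ n * 25 ^ (2 * n + 1) := by
    calc 2 ^ (n + 1) * 3 ^ (n + 1) = 6 ^ (n + 1) := by rw [← mul_pow]; norm_num
      _ < 25 ^ (n + 1) := Nat.pow_lt_pow_left (by norm_num) (by lia)
      _ ≤ 25 ^ (2 * n + 1) := Nat.pow_le_pow_right (by norm_num) (by lia)
      _ ≤ r ^ n * 25 ^ (2 * n + 1) := Nat.le_mul_of_pos_left _ (by positivity)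
  obtain ⟨k, l, hk, hl, h⟩ := exists_pos_mul_add_mul_eq (by positivity) (by positivity)
    (Nat.Coprime.pow (n + 1) (n + 1) (by norm_num : Nat.Coprime 2 3)) hlt
  refine ⟨k, l, hk, hl, ?_⟩
  have hQ : (k : ℚ) * 2 ^ (n + 1) + l * 3 ^ (n + 1) = r ^ n * 25 ^ (2 * n + 1) := by
    exact_mod_cast h
  have hsq : (25 : ℚ) ^ ((n + 1) ^ 2) = 25 ^ (n ^ 2) * 25 ^ (2 * n + 1) := by ring
  unfold gen
  push_cast
  rw [hsq, ← mul_div_assoc, ← mul_div_assoc, ← add_div, hQ]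
  field_simp

lemma not_isAtom_gen_sup {r : ℕ} (hr : 0 < r) (n : ℕ) :
    ¬ IsAtom (genMonoid 2 ⊔ genMonoid 3) (gen r n) := by
  rintro ⟨-, -, h⟩
  obtain ⟨k, l, hk, hl, heq⟩ := exists_gen_eq hr n
  have mem2 : gen 2 (n + 1) ∈ genMonoid 2 ⊔ genMonoid 3 :=
    le_sup_left (a := genMonoid 2) (AddSubmonoid.subset_closure ⟨n + 1, rfl⟩)
  have mem3 : gen 3 (n + 1) ∈ genMonoid 2 ⊔ genMonoid 3 :=
    le_sup_right (b := genMonoid 3) (AddSubmonoid.subset_closure ⟨n + 1, rfl⟩)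
  have h2 := gen_pos (p := 2) (by norm_num) (n + 1)
  have h3 := gen_pos (p := 3) (by norm_num) (n + 1)
  rcases h _ (nsmul_mem mem2 k) _ (nsmul_mem mem3 l) (by simpa using heq) with h0 | h0
  · exact (nsmul_pos h2 hk.ne').ne' h0
  · exact (nsmul_pos h3 hl.ne').ne' h0

/-- There exist atomic Puiseux monoids `M₁` and `M₂` whose internal sum
`M₁ + M₂` is a nontrivial antimatter monoid (it has no atoms and is not the
trivial monoid `{0}`). -/
theorem exists_atomic_atomic_sum_antimatter :
    ∃ M₁ M₂ : AddSubmonoid ℚ,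
      (∀ x ∈ M₁, (0 : ℚ) ≤ x) ∧ (∀ x ∈ M₂, (0 : ℚ) ≤ x) ∧
      Atomic M₁ ∧ Atomic M₂ ∧
      {a : ℚ | IsAtom (M₁ ⊔ M₂) a} = ∅ ∧ M₁ ⊔ M₂ ≠ ⊥ := by
  refine ⟨genMonoid 2, genMonoid 3, fun x hx => nonneg_of_mem_genMonoid hx,
    fun x hx => nonneg_of_mem_genMonoid hx, atomic_genMonoid (by norm_num) (by norm_num)
    (by norm_num), atomic_genMonoid (by norm_num) (by norm_num) (by norm_num), ?_, ?_⟩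
  · refine Set.eq_empty_of_forall_notMem fun a (ha : IsAtom _ a) => ?_
    have hmem : a ∈ Set.range (gen 2) ∪ Set.range (gen 3) :=
      IsAtom.mem_of_closure (by rwa [AddSubmonoid.closure_union])
    rcases hmem with ⟨n, rfl⟩ | ⟨n, rfl⟩
    · exact not_isAtom_gen_sup (by norm_num) n ha
    · exact not_isAtom_gen_sup (by norm_num) n ha
  · intro h
    have hmem : gen 2 0 ∈ genMonoid 2 ⊔ genMonoid 3 :=
      le_sup_left (a := genMonoid 2) (AddSubmonoid.subset_closure ⟨0, rfl⟩)
    rw [h, AddSubmonoid.mem_bot] at hmem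
    exact (gen_pos (by norm_num) 0).ne' hmem

end PuiseuxSum
end
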